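/- Let F ∈ ℂ^{2n×2n}, G ∈ ℂ^{2n×2m}, H ∈ ℂ^{2m×2n}, K ∈ ℂ^{2m×2m} be doubled-up matrices and suppose: (i) the transfer function Γ(s) = H(sI − F)^{−1}G + K is dual (J,J)-unitary; (ii) K K† = I_{2m} and K J_m K† = J_m; and (iii) there exists an invertible doubled-up matrix T ∈ ℂ^{2n×2n} such that Θ := T J_n T† satisfies FΘ + ΘF† + G J_m G† = 0 and K J_m G† + HΘ = 0. Then the quadruple (F, G, H, K) is physically realizable. -/

import Mathlib

open Matrix

noncomputable section

/-- `J_k = [[I, 0],[0, −I]]`. -/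
def Jmat (k : ℕ) : Matrix (Fin k ⊕ Fin k) (Fin k ⊕ Fin k) ℂ :=
  Matrix.fromBlocks 1 0 0 (-1)

/-- `Σ_k = [[0, I],[I, 0]]`. -/
def SigmaMat (k : ℕ) : Matrix (Fin k ⊕ Fin k) (Fin k ⊕ Fin k) ℂ :=
  Matrix.fromBlocks 0 1 1 0

/-- Entrywise complex conjugate of a matrix. -/
def conjMat {α β : Type*} (R : Matrix α β ℂ) : Matrix α β ℂ :=
  R.map (starRingEnd ℂ)

/-- `R ∈ ℂ^{2n×2m}` is doubled-up if `R Σ_m = Σ_n R^#`. -/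
def DoubledUp {n m : ℕ} (R : Matrix (Fin n ⊕ Fin n) (Fin m ⊕ Fin m) ℂ) : Prop :=
  R * SigmaMat m = SigmaMat n * conjMat R

/-- Physical realizability of the QSDE matrices `(F, G, H, K)`: there exist an invertible
doubled-up `T`, a Hermitian doubled-up `M`, a doubled-up `N` and `S` with `S†S = I` such that,
with `Θ := T J_n T†`: `F = −iΘM − (1/2)Θ N† J_m N`, `G = −Θ N† diag(S, −S^#)`, `H = N`,
`K = diag(S, S^#)`. -/
def PhysicallyRealizable {n m : ℕ}
    (F : Matrix (Fin n ⊕ Fin n) (Fin n ⊕ Fin n) ℂ)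
    (G : Matrix (Fin n ⊕ Fin n) (Fin m ⊕ Fin m) ℂ)
    (H : Matrix (Fin m ⊕ Fin m) (Fin n ⊕ Fin n) ℂ)
    (K : Matrix (Fin m ⊕ Fin m) (Fin m ⊕ Fin m) ℂ) : Prop :=
  ∃ (T M : Matrix (Fin n ⊕ Fin n) (Fin n ⊕ Fin n) ℂ)
    (N : Matrix (Fin m ⊕ Fin m) (Fin n ⊕ Fin n) ℂ)
    (S : Matrix (Fin m) (Fin m) ℂ),
      IsUnit T ∧ DoubledUp T ∧ Mᴴ = M ∧ DoubledUp M ∧ DoubledUp N ∧ Sᴴ * S = 1 ∧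
      F = -(Complex.I • ((T * Jmat n * Tᴴ) * M)) -
            (1 / 2 : ℂ) • ((T * Jmat n * Tᴴ) * Nᴴ * Jmat m * N) ∧
      G = -((T * Jmat n * Tᴴ) * Nᴴ * Matrix.fromBlocks S 0 0 (-(conjMat S))) ∧
      H = N ∧
      K = Matrix.fromBlocks S 0 0 (conjMat S)

/-- The transfer function `Γ(s) = H (sI − F)⁻¹ G + K`. -/
def transferFn {N M P : Type*} [Fintype N] [DecidableEq N]
    (F : Matrix N N ℂ) (G : Matrix N M ℂ) (H : Matrix P N ℂ) (K : Matrix P M ℂ)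
    (s : ℂ) : Matrix P M ℂ :=
  H * (s • (1 : Matrix N N ℂ) - F)⁻¹ * G + K

/-- `Γ` is dual `(J,J)`-unitary: `Γ(s) J_m Γ(−s̄)† = J_m` for all `s` with `Re s ≥ 0`
such that both `sI − F` and `−s̄I − F` are invertible. -/
def DualJJUnitary {n m : ℕ}
    (F : Matrix (Fin n ⊕ Fin n) (Fin n ⊕ Fin n) ℂ)
    (G : Matrix (Fin n ⊕ Fin n) (Fin m ⊕ Fin m) ℂ)
    (H : Matrix (Fin m ⊕ Fin m) (Fin n ⊕ Fin n) ℂ)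
    (K : Matrix (Fin m ⊕ Fin m) (Fin m ⊕ Fin m) ℂ) : Prop :=
  ∀ s : ℂ, 0 ≤ s.re →
    IsUnit (s • (1 : Matrix (Fin n ⊕ Fin n) (Fin n ⊕ Fin n) ℂ) - F) →
    IsUnit ((-(starRingEnd ℂ s)) • (1 : Matrix (Fin n ⊕ Fin n) (Fin n ⊕ Fin n) ℂ) - F) →
    transferFn F G H K s * Jmat m * (transferFn F G H K (-(starRingEnd ℂ s)))ᴴ = Jmat m

/-- The involution `R ↦ Σ R^# Σ`, whose fixed points are the doubled-up matrices. -/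
def sigmaConj {n m : ℕ} (R : Matrix (Fin n ⊕ Fin n) (Fin m ⊕ Fin m) ℂ) :
    Matrix (Fin n ⊕ Fin n) (Fin m ⊕ Fin m) ℂ :=
  SigmaMat n * conjMat R * SigmaMat m

lemma SigmaMat_mul_self (k : ℕ) : SigmaMat k * SigmaMat k = 1 := by
  simp [SigmaMat, fromBlocks_multiply]

lemma SigmaMat_mul_cancel_left {k : ℕ} {α : Type*} (R : Matrix (Fin k ⊕ Fin k) α ℂ) :
    SigmaMat k * (SigmaMat k * R) = R := by
  rw [← Matrix.mul_assoc, SigmaMat_mul_self, Matrix.one_mul]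

lemma Jmat_mul_self (k : ℕ) : Jmat k * Jmat k = 1 := by
  simp [Jmat, fromBlocks_multiply]

lemma conjTranspose_Jmat (k : ℕ) : (Jmat k)ᴴ = Jmat k := by
  simp [Jmat, fromBlocks_conjTranspose]

lemma conjTranspose_SigmaMat (k : ℕ) : (SigmaMat k)ᴴ = SigmaMat k := by
  simp [SigmaMat, fromBlocks_conjTranspose]

lemma conjMat_mul {α β γ : Type*} [Fintype β] (A : Matrix α β ℂ) (B : Matrix β γ ℂ) :
    conjMat (A * B) = conjMat A * conjMat B :=
  Matrix.map_mul

lemma conjMat_conjTranspose {α β : Type*} (A : Matrix α β ℂ) :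
    conjMat Aᴴ = (conjMat A)ᴴ := by
  ext i j
  simp [conjMat]

lemma doubledUp_iff {n m : ℕ} {R : Matrix (Fin n ⊕ Fin n) (Fin m ⊕ Fin m) ℂ} :
    DoubledUp R ↔ sigmaConj R = R := by
  unfold DoubledUp sigmaConj
  constructor
  · intro h
    rw [← h, Matrix.mul_assoc, SigmaMat_mul_self, Matrix.mul_one]
  · intro h
    nth_rewrite 1 [← h]
    rw [Matrix.mul_assoc, SigmaMat_mul_self, Matrix.mul_one]

lemma sigmaConj_mul {n m k : ℕ} (A : Matrix (Fin n ⊕ Fin n) (Fin m ⊕ Fin m) ℂ)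
    (B : Matrix (Fin m ⊕ Fin m) (Fin k ⊕ Fin k) ℂ) :
    sigmaConj (A * B) = sigmaConj A * sigmaConj B := by
  simp only [sigmaConj, conjMat_mul, Matrix.mul_assoc, SigmaMat_mul_cancel_left]

lemma sigmaConj_add {n m : ℕ} (A B : Matrix (Fin n ⊕ Fin n) (Fin m ⊕ Fin m) ℂ) :
    sigmaConj (A + B) = sigmaConj A + sigmaConj B := by
  have h : conjMat (A + B) = conjMat A + conjMat B := by
    ext i j
    simp [conjMat]
  simp only [sigmaConj, h, Matrix.mul_add, Matrix.add_mul]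

lemma sigmaConj_smul {n m : ℕ} (c : ℂ) (A : Matrix (Fin n ⊕ Fin n) (Fin m ⊕ Fin m) ℂ) :
    sigmaConj (c • A) = starRingEnd ℂ c • sigmaConj A := by
  have h : conjMat (c • A) = starRingEnd ℂ c • conjMat A := by
    ext i j
    simp [conjMat]
  simp only [sigmaConj, h, Matrix.mul_smul, Matrix.smul_mul]

lemma sigmaConj_one (n : ℕ) :
    sigmaConj (1 : Matrix (Fin n ⊕ Fin n) (Fin n ⊕ Fin n) ℂ) = 1 := by
  have h : conjMat (1 : Matrix (Fin n ⊕ Fin n) (Fin n ⊕ Fin n) ℂ) = 1 :=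
    Matrix.map_one _ (map_zero _) (map_one _)
  rw [sigmaConj, h, Matrix.mul_one, SigmaMat_mul_self]

lemma sigmaConj_conjTranspose {n m : ℕ} (A : Matrix (Fin n ⊕ Fin n) (Fin m ⊕ Fin m) ℂ) :
    sigmaConj Aᴴ = (sigmaConj A)ᴴ := by
  simp only [sigmaConj, conjMat_conjTranspose, conjTranspose_mul, conjTranspose_SigmaMat,
    Matrix.mul_assoc]

lemma sigmaConj_Jmat (k : ℕ) : sigmaConj (Jmat k) = -Jmat k := by
  have h : conjMat (Jmat k) = Jmat k := by
    ext i j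
    rcases i with i | i <;> rcases j with j | j <;>
      simp [conjMat, Jmat, Matrix.one_apply, apply_ite (starRingEnd ℂ)]
  rw [sigmaConj, h]
  simp [Jmat, SigmaMat, fromBlocks_multiply, fromBlocks_neg]

/-- A doubled-up matrix commuting with `J` is of the form `diag(S, S^#)`. -/
lemma DoubledUp.eq_fromBlocks_of_commute_Jmat {m : ℕ}
    {K : Matrix (Fin m ⊕ Fin m) (Fin m ⊕ Fin m) ℂ} (hK : DoubledUp K)
    (hJ : K * Jmat m = Jmat m * K) :
    K = fromBlocks K.toBlocks₁₁ 0 0 (conjMat K.toBlocks₁₁) := by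
  obtain ⟨A, B, C, D, rfl⟩ : ∃ A B C D, K = fromBlocks A B C D :=
    ⟨_, _, _, _, (fromBlocks_toBlocks K).symm⟩
  have hc : conjMat (fromBlocks A B C D) =
      fromBlocks (conjMat A) (conjMat B) (conjMat C) (conjMat D) :=
    fromBlocks_map _ _ _ _ _
  simp only [DoubledUp, SigmaMat, hc, fromBlocks_multiply, Matrix.mul_zero, Matrix.zero_mul,
    Matrix.mul_one, Matrix.one_mul, zero_add, add_zero, fromBlocks_inj] at hK
  simp only [Jmat, fromBlocks_multiply, Matrix.mul_zero, Matrix.zero_mul, Matrix.mul_one,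
    Matrix.one_mul, zero_add, add_zero, fromBlocks_inj, Matrix.mul_neg, Matrix.neg_mul] at hJ
  rw [toBlocks_fromBlocks₁₁, fromBlocks_inj]
  have h0 {X : Matrix (Fin m) (Fin m) ℂ} (h : X = -X) : X = 0 := by
    ext i j
    exact self_eq_neg.1 (congrFun (congrFun h i) j)
  exact ⟨rfl, h0 hJ.2.1.symm, h0 hJ.2.2.1, hK.2.2.1⟩

/-- if the doubled-up quadruple `(F,G,H,K)` has a dual `(J,J)`-unitary transfer
function, `K K† = I`, `K J_m K† = J_m`, and there is an invertible doubled-up `T` with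
`Θ := T J_n T†` satisfying `FΘ + ΘF† + G J_m G† = 0` and `K J_m G† + HΘ = 0`, then
`(F,G,H,K)` is physically realizable. -/
theorem stmt6 (n m : ℕ) (hn : 0 < n) (hm : 0 < m)
    (F : Matrix (Fin n ⊕ Fin n) (Fin n ⊕ Fin n) ℂ)
    (G : Matrix (Fin n ⊕ Fin n) (Fin m ⊕ Fin m) ℂ)
    (H : Matrix (Fin m ⊕ Fin m) (Fin n ⊕ Fin n) ℂ)
    (K : Matrix (Fin m ⊕ Fin m) (Fin m ⊕ Fin m) ℂ)
    (hF : DoubledUp F) (hG : DoubledUp G) (hH : DoubledUp H) (hK : DoubledUp K)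
    (hJJ : DualJJUnitary F G H K)
    (hKK : K * Kᴴ = 1)
    (hKJK : K * Jmat m * Kᴴ = Jmat m)
    (hT : ∃ T : Matrix (Fin n ⊕ Fin n) (Fin n ⊕ Fin n) ℂ, IsUnit T ∧ DoubledUp T ∧
      F * (T * Jmat n * Tᴴ) + (T * Jmat n * Tᴴ) * Fᴴ + G * Jmat m * Gᴴ = 0 ∧
      K * Jmat m * Gᴴ + H * (T * Jmat n * Tᴴ) = 0) :
    PhysicallyRealizable F G H K := by
  obtain ⟨T, hTu, hTd, hLyap, hout⟩ := hT
  have hKK' : Kᴴ * K = 1 := mul_eq_one_comm.1 hKK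
  have hcomm : K * Jmat m = Jmat m * K := by
    calc K * Jmat m = K * Jmat m * (Kᴴ * K) := by rw [hKK', Matrix.mul_one]
      _ = K * Jmat m * Kᴴ * K := by simp only [Matrix.mul_assoc]
      _ = Jmat m * K := by rw [hKJK]
  have hKb := hK.eq_fromBlocks_of_commute_Jmat hcomm
  set S := K.toBlocks₁₁
  have hSS : Sᴴ * S = 1 := by
    rw [hKb, fromBlocks_conjTranspose, fromBlocks_multiply, ← fromBlocks_one,
      fromBlocks_inj] at hKK'
    simpa using hKK'.1
  have hKJ : fromBlocks S 0 0 (-(conjMat S)) = K * Jmat m := by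
    rw [hKb]
    simp [Jmat, fromBlocks_multiply]
  have hJu : IsUnit (Jmat n) := .of_mul_eq_one _ (Jmat_mul_self n)
  have hΘu : IsUnit (T * Jmat n * Tᴴ) := (hTu.mul hJu).mul hTu.star
  have hΘh : (T * Jmat n * Tᴴ)ᴴ = T * Jmat n * Tᴴ := by
    simp only [conjTranspose_mul, conjTranspose_conjTranspose, conjTranspose_Jmat,
      Matrix.mul_assoc]
  have hΘd : sigmaConj (T * Jmat n * Tᴴ) = -(T * Jmat n * Tᴴ) := by
    rw [sigmaConj_mul, sigmaConj_mul, sigmaConj_conjTranspose, doubledUp_iff.1 hTd,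
      sigmaConj_Jmat, Matrix.mul_neg, Matrix.neg_mul]
  generalize hΘ : T * Jmat n * Tᴴ = Θ at *
  have hdet := (Matrix.isUnit_iff_isUnit_det _).1 hΘu
  have hinv : Θ * Θ⁻¹ = 1 := Matrix.mul_nonsing_inv _ hdet
  have hinv' : Θ⁻¹ * Θ = 1 := Matrix.nonsing_inv_mul _ hdet
  have hinvh : Θ⁻¹ᴴ = Θ⁻¹ := by rw [conjTranspose_nonsing_inv, hΘh]
  have hinvd : sigmaConj Θ⁻¹ = -Θ⁻¹ := by
    have h : Θ * sigmaConj Θ⁻¹ = -1 := by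
      have := congrArg sigmaConj hinv
      rw [sigmaConj_mul, hΘd, sigmaConj_one, Matrix.neg_mul] at this
      rw [← this, neg_neg]
    calc sigmaConj Θ⁻¹ = Θ⁻¹ * (Θ * sigmaConj Θ⁻¹) := by
          rw [← Matrix.mul_assoc, hinv', Matrix.one_mul]
      _ = -Θ⁻¹ := by rw [h, Matrix.mul_neg, Matrix.mul_one]
  have hGeq : G = -(Θ * Hᴴ * (K * Jmat m)) := by
    have h := congrArg conjTranspose (eq_neg_of_add_eq_zero_left hout)
    simp only [conjTranspose_mul, conjTranspose_neg, conjTranspose_conjTranspose,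
      conjTranspose_Jmat, hΘh] at h
    calc G = G * (Jmat m * (Kᴴ * K) * Jmat m) := by
          rw [hKK', Matrix.mul_one, Jmat_mul_self, Matrix.mul_one]
      _ = G * (Jmat m * Kᴴ) * (K * Jmat m) := by simp only [Matrix.mul_assoc]
      _ = -(Θ * Hᴴ * (K * Jmat m)) := by rw [h, Matrix.neg_mul]
  have hGG : G * Jmat m * Gᴴ = Θ * Hᴴ * Jmat m * H * Θ := by
    have h : (K * Jmat m) * Jmat m * (K * Jmat m)ᴴ = Jmat m := by
      rw [conjTranspose_mul, conjTranspose_Jmat, Matrix.mul_assoc K, Jmat_mul_self,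
        Matrix.mul_one, ← Matrix.mul_assoc, hKJK]
    calc G * Jmat m * Gᴴ
        = Θ * Hᴴ * ((K * Jmat m) * Jmat m * (K * Jmat m)ᴴ) * H * Θ := by
          rw [hGeq]
          simp only [conjTranspose_neg, conjTranspose_mul, conjTranspose_conjTranspose, hΘh,
            Matrix.neg_mul, Matrix.mul_neg, neg_neg, Matrix.mul_assoc]
      _ = _ := by rw [h]
  have hLyap' : Θ⁻¹ * F + Fᴴ * Θ⁻¹ + Hᴴ * Jmat m * H = 0 := by
    rw [hGG] at hLyap
    calc Θ⁻¹ * F + Fᴴ * Θ⁻¹ + Hᴴ * Jmat m * H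
        = Θ⁻¹ * F * (Θ * Θ⁻¹) + (Θ⁻¹ * Θ) * Fᴴ * Θ⁻¹
            + (Θ⁻¹ * Θ) * Hᴴ * Jmat m * H * (Θ * Θ⁻¹) := by
          simp only [hinv, hinv', Matrix.one_mul, Matrix.mul_one]
      _ = Θ⁻¹ * (F * Θ + Θ * Fᴴ + Θ * Hᴴ * Jmat m * H * Θ) * Θ⁻¹ := by
          simp only [Matrix.mul_add, Matrix.add_mul, Matrix.mul_assoc]
      _ = 0 := by rw [hLyap, Matrix.mul_zero, Matrix.zero_mul]
  refine ⟨T, Complex.I • (Θ⁻¹ * F + (1 / 2 : ℂ) • (Hᴴ * Jmat m * H)), H, S, hTu, hTd, ?_, ?_,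
    hH, hSS, ?_, ?_, rfl, hKb⟩
  · have h2 : Fᴴ * Θ⁻¹ = -(Θ⁻¹ * F) - Hᴴ * Jmat m * H := by
      rw [← sub_eq_zero, ← hLyap']
      abel
    simp only [conjTranspose_smul, conjTranspose_add, conjTranspose_mul, conjTranspose_Jmat,
      conjTranspose_conjTranspose, hinvh, h2, ← Matrix.mul_assoc]
    simp only [Complex.star_def, Complex.conj_I, map_div₀, map_one, map_ofNat]
    module
  · rw [doubledUp_iff]
    simp only [sigmaConj_smul, sigmaConj_add, sigmaConj_mul, sigmaConj_conjTranspose,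
      sigmaConj_Jmat, hinvd, doubledUp_iff.1 hF, doubledUp_iff.1 hH, Complex.conj_I, map_div₀,
      map_one, map_ofNat, Matrix.mul_neg, Matrix.neg_mul]
    module
  · rw [hΘ]
    simp only [Matrix.mul_smul, Matrix.mul_add, smul_smul, ← Matrix.mul_assoc, hinv,
      Matrix.one_mul, Complex.I_mul_I]
    module
  · rw [hΘ, hKJ, ← hGeq]
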